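/- Let B be a symmetric positive definite real m×m matrix, H a real p×m matrix, and let R and R₀ be symmetric positive definite real p×p matrices. Set D = R₀⁻¹ H (B + Hᵀ R₀⁻¹ H)⁻² Hᵀ R₀⁻¹. Then Tr((B + Hᵀ R⁻¹ H)⁻¹) ≤ Tr((B + Hᵀ R₀⁻¹ H)⁻¹) + Tr(D (R − R₀)), with equality when R = R₀. -/

import Mathlib

open Matrix

/-- Completion of squares for the Joseph form of the posterior covariance: with the optimal gain
`G = (B + Hᵀ R⁻¹ H)⁻¹ Hᵀ R⁻¹`, the gain `G + E` exceeds the optimal value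
`(B + Hᵀ R⁻¹ H)⁻¹` by `E (R + H B⁻¹ Hᵀ) Eᵀ`. -/
theorem joseph_form_eq {m p : Type*} [Fintype m] [Fintype p] [DecidableEq m] [DecidableEq p]
    {B : Matrix m m ℝ} (hB : B.PosDef) (H : Matrix p m ℝ)
    {R : Matrix p p ℝ} (hR : R.PosDef) (E : Matrix m p ℝ) :
    (1 - ((B + Hᵀ * R⁻¹ * H)⁻¹ * Hᵀ * R⁻¹ + E) * H) * B⁻¹ *
        (1 - ((B + Hᵀ * R⁻¹ * H)⁻¹ * Hᵀ * R⁻¹ + E) * H)ᵀ +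
      ((B + Hᵀ * R⁻¹ * H)⁻¹ * Hᵀ * R⁻¹ + E) * R *
        ((B + Hᵀ * R⁻¹ * H)⁻¹ * Hᵀ * R⁻¹ + E)ᵀ =
    (B + Hᵀ * R⁻¹ * H)⁻¹ + E * (R + H * B⁻¹ * Hᵀ) * Eᵀ := by
  have hC : (B + Hᵀ * R⁻¹ * H).PosDef := by
    have h := hR.inv.posSemidef.conjTranspose_mul_mul_same H
    rw [conjTranspose_eq_transpose_of_trivial] at h
    exact hB.add_posSemidef h
  have hBu := (isUnit_iff_isUnit_det _).mp hB.isUnit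
  have hRu := (isUnit_iff_isUnit_det _).mp hR.isUnit
  have hCu := (isUnit_iff_isUnit_det _).mp hC.isUnit
  have hBt : Bᵀ = B := hB.isHermitian
  have hRt : R⁻¹ᵀ = R⁻¹ := hR.inv.isHermitian
  have hPt : (B + Hᵀ * R⁻¹ * H)⁻¹ᵀ = (B + Hᵀ * R⁻¹ * H)⁻¹ := hC.inv.isHermitian
  have hPC := nonsing_inv_mul _ hCu
  have hCP := mul_nonsing_inv _ hCu
  generalize (B + Hᵀ * R⁻¹ * H)⁻¹ = P at *
  have hgain : 1 - (P * Hᵀ * R⁻¹ + E) * H = P * B - E * H := by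
    rw [← hPC]
    simp only [Matrix.mul_add, Matrix.add_mul, Matrix.mul_assoc]
    abel
  have hP : P * (B * P) + P * (Hᵀ * (R⁻¹ * (H * P))) = P := by
    calc _ = P * ((B + Hᵀ * R⁻¹ * H) * P) := by
          simp only [Matrix.mul_add, Matrix.add_mul, Matrix.mul_assoc]
      _ = P := by rw [hCP, Matrix.mul_one]
  rw [hgain]
  simp only [transpose_sub, transpose_add, transpose_mul, transpose_transpose, hBt, hRt, hPt,
    Matrix.mul_add, Matrix.add_mul, Matrix.mul_sub, Matrix.sub_mul, Matrix.mul_assoc,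
    mul_nonsing_inv_cancel_left _ _ hBu, nonsing_inv_mul_cancel_left _ _ hBu,
    mul_nonsing_inv_cancel_left _ _ hRu, nonsing_inv_mul_cancel_left _ _ hRu]
  conv_rhs => rw [← hP]
  abel

/-- First-order majorization inequality (eq. (37)): with
`D = R₀⁻¹ H (B + Hᵀ R₀⁻¹ H)⁻² Hᵀ R₀⁻¹`,
`Tr((B + Hᵀ R⁻¹ H)⁻¹) ≤ Tr((B + Hᵀ R₀⁻¹ H)⁻¹) + Tr(D (R − R₀))`,
with equality when `R = R₀`. -/
theorem stmt_6 (m p : ℕ)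
    (B : Matrix (Fin m) (Fin m) ℝ) (hB : B.PosDef)
    (H : Matrix (Fin p) (Fin m) ℝ)
    (R R₀ : Matrix (Fin p) (Fin p) ℝ) (hR : R.PosDef) (hR₀ : R₀.PosDef)
    (D : Matrix (Fin p) (Fin p) ℝ)
    (hD : D = R₀⁻¹ * H * ((B + Hᵀ * R₀⁻¹ * H)⁻¹ * (B + Hᵀ * R₀⁻¹ * H)⁻¹) * Hᵀ * R₀⁻¹) :
    ((B + Hᵀ * R⁻¹ * H)⁻¹).trace ≤
      ((B + Hᵀ * R₀⁻¹ * H)⁻¹).trace + (D * (R - R₀)).trace ∧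
    ((B + Hᵀ * R₀⁻¹ * H)⁻¹).trace =
      ((B + Hᵀ * R₀⁻¹ * H)⁻¹).trace + (D * (R₀ - R₀)).trace := by
  refine ⟨?_, by simp⟩
  have hP₀t : (B + Hᵀ * R₀⁻¹ * H)⁻¹ᵀ = (B + Hᵀ * R₀⁻¹ * H)⁻¹ := by
    have hBt : Bᵀ = B := hB.isHermitian
    have hRt : R₀ᵀ = R₀ := hR₀.isHermitian
    simp [transpose_nonsing_inv, hBt, hRt, Matrix.mul_assoc]
  have hRt : R₀⁻¹ᵀ = R₀⁻¹ := hR₀.inv.isHermitian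
  have h₀ := joseph_form_eq hB H hR₀ 0
  have h := joseph_form_eq hB H hR
    ((B + Hᵀ * R₀⁻¹ * H)⁻¹ * Hᵀ * R₀⁻¹ - (B + Hᵀ * R⁻¹ * H)⁻¹ * Hᵀ * R⁻¹)
  rw [add_zero, Matrix.zero_mul, Matrix.zero_mul, add_zero] at h₀
  rw [add_sub_cancel] at h
  generalize hE : (B + Hᵀ * R₀⁻¹ * H)⁻¹ * Hᵀ * R₀⁻¹ - (B + Hᵀ * R⁻¹ * H)⁻¹ * Hᵀ * R⁻¹ = E at h
  generalize hK : (B + Hᵀ * R₀⁻¹ * H)⁻¹ * Hᵀ * R₀⁻¹ = K at h h₀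
  have hDK : D = Kᵀ * K := by
    rw [hD, ← hK]
    rw [transpose_mul, transpose_mul, hP₀t, hRt, transpose_transpose]
    simp only [Matrix.mul_assoc]
  have hpsd : (E * (R + H * B⁻¹ * Hᵀ) * Eᵀ).PosSemidef := by
    have h₁ := hB.inv.posSemidef.mul_mul_conjTranspose_same H
    have h₂ := (hR.posSemidef.add h₁).mul_mul_conjTranspose_same E
    simpa only [conjTranspose_eq_transpose_of_trivial] using h₂
  have htr : (D * (R - R₀)).trace = (K * R * Kᵀ).trace - (K * R₀ * Kᵀ).trace := by
    rw [hDK, Matrix.mul_assoc, trace_mul_comm, Matrix.mul_sub, Matrix.sub_mul, trace_sub]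
  have ht := congrArg trace h
  have ht₀ := congrArg trace h₀
  rw [trace_add, trace_add] at ht
  rw [trace_add] at ht₀
  linarith [hpsd.trace_nonneg]
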